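/- Let S be the unilateral shift on ℓ²(ℕ, ℂ) and 𝒯 the Toeplitz algebra, the smallest norm-closed star-subalgebra of bounded operators on ℓ²(ℕ, ℂ) containing S and the identity. Then the character space of 𝒯 is homeomorphic to the unit circle 𝕋 = {λ ∈ ℂ : |λ| = 1}; explicitly, the map sending a character χ to χ(S) is a homeomorphism from the character space of 𝒯 (with its weak* topology) onto 𝕋. -/

import Mathlib

open Filter Topology ComplexConjugate

namespace Toep

variable {H : Type*} [NormedAddCommGroup H] [InnerProductSpace ℂ H]

/-- `T` has approximate eigenvalue `c` along `v`. -/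
def R (v : ℕ → H) (T : H →L[ℂ] H) (c : ℂ) : Prop :=
  Tendsto (fun n => T (v n) - c • v n) atTop (𝓝 0)

variable {v : ℕ → H}

lemma R.bound (hv : ∀ n, ‖v n‖ = 1) {T : H →L[ℂ] H} {c : ℂ} (h : R v T c) : ‖c‖ ≤ ‖T‖ := by
  have h1 : Tendsto (fun n => ‖T (v n) - c • v n‖ + ‖T‖) atTop (𝓝 (0 + ‖T‖)) := by
    simpa using h.norm.add_const ‖T‖
  rw [zero_add] at h1
  refine ge_of_tendsto' h1 fun n => ?_
  have h2 : c • v n = T (v n) - (T (v n) - c • v n) := by abel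
  have h3 : ‖c • v n‖ ≤ ‖T (v n)‖ + ‖T (v n) - c • v n‖ := by
    conv_lhs => rw [h2]
    exact norm_sub_le _ _
  have h4 := T.le_opNorm (v n)
  rw [norm_smul, hv] at h3
  rw [hv] at h4
  linarith

lemma R.add {T U : H →L[ℂ] H} {c d : ℂ} (h : R v T c) (k : R v U d) : R v (T + U) (c + d) := by
  have := Tendsto.add h k
  rw [add_zero] at this
  refine this.congr fun n => ?_
  simp only [add_apply, add_smul]
  abel

lemma R.mul {T U : H →L[ℂ] H} {c d : ℂ} (h : R v T c) (k : R v U d) : R v (T * U) (c * d) := by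
  have h1 : Tendsto (fun n => T (U (v n) - d • v n)) atTop (𝓝 0) := by
    have := (T.continuous.tendsto 0).comp k
    rwa [map_zero] at this
  have h2 : Tendsto (fun n => d • (T (v n) - c • v n)) atTop (𝓝 0) := by
    simpa using Tendsto.const_smul h d
  have := h1.add h2
  rw [add_zero] at this
  refine this.congr fun n => ?_
  simp only [mul_apply_eq_comp, map_sub, map_smul, smul_sub, smul_smul, mul_comm c d]
  abel

lemma R.algMap (c : ℂ) : R v (algebraMap ℂ (H →L[ℂ] H) c) c := by
  simp [R, Algebra.algebraMap_eq_smul_one]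

lemma R.neg {T : H →L[ℂ] H} {c : ℂ} (h : R v T c) : R v (-T) (-c) := by
  have := (R.algMap (v := v) (-1)).mul h
  simpa using this

lemma R.sub {T U : H →L[ℂ] H} {c d : ℂ} (h : R v T c) (k : R v U d) : R v (T - U) (c - d) := by
  simpa [sub_eq_add_neg] using h.add k.neg

lemma R.unique (hv : ∀ n, ‖v n‖ = 1) {T : H →L[ℂ] H} {c d : ℂ} (h : R v T c) (k : R v T d) :
    c = d := by
  have := (h.sub k).bound hv
  simpa [sub_eq_zero] using this

lemma R.lim (hv : ∀ n, ‖v n‖ = 1) {T : ℕ → H →L[ℂ] H} {c : ℕ → ℂ} {T' : H →L[ℂ] H} {c' : ℂ}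
    (h : ∀ n, R v (T n) (c n)) (hT : Tendsto T atTop (𝓝 T')) (hc : Tendsto c atTop (𝓝 c')) :
    R v T' c' := by
  rw [R, Metric.tendsto_atTop]
  intro ε hε
  obtain ⟨N1, h1⟩ := Metric.tendsto_atTop.1 hT (ε / 3) (by positivity)
  obtain ⟨N2, h2⟩ := Metric.tendsto_atTop.1 hc (ε / 3) (by positivity)
  have h1 := h1 (max N1 N2) (le_max_left _ _)
  have h2 := h2 (max N1 N2) (le_max_right _ _)
  obtain ⟨M, hM⟩ := Metric.tendsto_atTop.1 (h (max N1 N2)) (ε / 3) (by positivity)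
  generalize max N1 N2 = N at *
  refine ⟨M, fun n hn => ?_⟩
  have h3 := hM n hn
  rw [dist_zero_right] at h3 ⊢
  rw [dist_comm, dist_eq_norm] at h1
  rw [dist_eq_norm] at h2
  have e : T' (v n) - c' • v n =
      (T' - T N) (v n) + (T N (v n) - c N • v n) + (c N - c') • v n := by
    simp only [sub_apply, sub_smul]; abel
  have h4 := (T' - T N).le_opNorm (v n)
  have h5 : ‖(c N - c') • v n‖ = ‖c N - c'‖ := by rw [norm_smul, hv, mul_one]
  rw [hv, mul_one] at h4
  rw [e]
  have h6 := norm_add₃_le (a := (T' - T N) (v n)) (b := T N (v n) - c N • v n)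
    (c := (c N - c') • v n)
  linarith

variable [CompleteSpace H]

/-- operators with a joint approximate eigenvalue. -/
def B (v : ℕ → H) : StarSubalgebra ℂ (H →L[ℂ] H) where
  carrier := {T | ∃ c, R v T c ∧ R v (star T) (conj c)}
  mul_mem' := by
    rintro T U ⟨c, h1, h2⟩ ⟨d, k1, k2⟩
    refine ⟨c * d, h1.mul k1, ?_⟩
    rw [star_mul, map_mul, mul_comm (conj c)]
    exact k2.mul h2
  add_mem' := by
    rintro T U ⟨c, h1, h2⟩ ⟨d, k1, k2⟩
    refine ⟨c + d, h1.add k1, ?_⟩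
    rw [star_add, map_add]
    exact h2.add k2
  algebraMap_mem' := by
    intro c
    refine ⟨c, R.algMap c, ?_⟩
    rw [← algebraMap_star_comm]
    exact R.algMap _
  star_mem' := by
    rintro T ⟨c, h1, h2⟩
    exact ⟨conj c, h2, by simpa using h1⟩

lemma B_closed (hv : ∀ n, ‖v n‖ = 1) : IsClosed (B v : Set (H →L[ℂ] H)) := by
  rw [← isSeqClosed_iff_isClosed]
  intro T T' hT hl
  choose c hc hc' using hT
  have hcau : CauchySeq c := by
    rw [Metric.cauchySeq_iff]
    intro ε hε
    obtain ⟨N, hN⟩ := Metric.cauchySeq_iff.1 hl.cauchySeq ε hε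
    refine ⟨N, fun m hm n hn => lt_of_le_of_lt ?_ (hN m hm n hn)⟩
    rw [dist_eq_norm, dist_eq_norm]
    exact ((hc m).sub (hc n)).bound hv
  obtain ⟨c', hl'⟩ := cauchySeq_tendsto_of_complete hcau
  refine ⟨c', R.lim hv hc hl hl', R.lim hv hc' ?_ ?_⟩
  · exact (continuous_star.tendsto T').comp hl
  · exact (Complex.continuous_conj.tendsto c').comp hl'

lemma exists_char (hv : ∀ n, ‖v n‖ = 1) (A : StarSubalgebra ℂ (H →L[ℂ] H)) (hA : A ≤ B v) :
    ∃ χ : A →ₐ[ℂ] ℂ, ∀ T : A, R v (T : H →L[ℂ] H) (χ T) := by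
  have : ∀ T : A, ∃ c, R v (T : H →L[ℂ] H) c := fun T => by
    obtain ⟨c, h, -⟩ := hA T.2
    exact ⟨c, h⟩
  choose f hf using this
  refine ⟨{ toFun := f, map_one' := ?_, map_mul' := ?_, map_zero' := ?_, map_add' := ?_,
            commutes' := ?_ }, hf⟩
  · refine (hf 1).unique hv ?_
    simpa using R.algMap (v := v) 1
  · exact fun T U => (hf _).unique hv ((hf T).mul (hf U))
  · refine (hf 0).unique hv ?_
    simpa using R.algMap (v := v) 0
  · exact fun T U => (hf _).unique hv ((hf T).add (hf U))
  · exact fun c => (hf _).unique hv (R.algMap (v := v) c)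

local notation "L2" => lp (fun _ : ℕ => ℂ) 2

lemma inner_shift (S : L2 →L[ℂ] L2)
    (hS0 : ∀ x : L2, (S x : ∀ _ : ℕ, ℂ) 0 = 0)
    (hS : ∀ (x : L2) (n : ℕ), (S x : ∀ _ : ℕ, ℂ) (n + 1) = (x : ∀ _ : ℕ, ℂ) n) (x y : L2) :
    inner ℂ x (S y) = ∑' n, inner ℂ ((x : ∀ _ : ℕ, ℂ) (n + 1)) ((y : ∀ _ : ℕ, ℂ) n) := by
  have h := lp.summable_inner (𝕜 := ℂ) x (S y)
  have h1 := h.tsum_eq_zero_add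
  rw [lp.inner_eq_tsum, h1, hS0]
  simp only [hS, inner_zero_right, zero_add]

lemma star_mul_self (S : L2 →L[ℂ] L2)
    (hS0 : ∀ x : L2, (S x : ∀ _ : ℕ, ℂ) 0 = 0)
    (hS : ∀ (x : L2) (n : ℕ), (S x : ∀ _ : ℕ, ℂ) (n + 1) = (x : ∀ _ : ℕ, ℂ) n) :
    star S * S = 1 := by
  ext1 x
  refine ext_inner_right ℂ fun y => ?_
  rw [mul_apply_eq_comp, ContinuousLinearMap.star_eq_adjoint,
    ContinuousLinearMap.adjoint_inner_left, inner_shift S hS0 hS,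
    one_apply_eq_self, lp.inner_eq_tsum]
  simp [hS]

lemma exists_vec (S : L2 →L[ℂ] L2)
    (hS0 : ∀ x : L2, (S x : ∀ _ : ℕ, ℂ) 0 = 0)
    (hS : ∀ (x : L2) (n : ℕ), (S x : ∀ _ : ℕ, ℂ) (n + 1) = (x : ∀ _ : ℕ, ℂ) n)
    (μ : ℂ) (hμ : ‖μ‖ < 1) : ∃ x : L2, ‖x‖ = 1 ∧ star S x = μ • x := by
  have hm : Memℓp (fun n : ℕ => μ ^ n) 2 := by
    apply memℓp_gen
    have : Summable fun n : ℕ => (‖μ‖ ^ 2) ^ n :=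
      summable_geometric_of_lt_one (by positivity) (by nlinarith [norm_nonneg μ])
    refine this.congr fun n => ?_
    simp [← pow_mul, mul_comm]
  let w : L2 := ⟨fun n => μ ^ n, hm⟩
  have hw : w ≠ 0 := fun h => by
    have : (w : ∀ _ : ℕ, ℂ) 0 = 0 := by rw [h]; rfl
    simp [w] at this
  have hSw : star S w = μ • w := by
    refine ext_inner_right ℂ fun y => ?_
    rw [ContinuousLinearMap.star_eq_adjoint,
      ContinuousLinearMap.adjoint_inner_left, inner_shift S hS0 hS, lp.inner_eq_tsum]
    refine tsum_congr fun n => ?_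
    simp [w, pow_succ, mul_comm]
  refine ⟨((‖w‖⁻¹ : ℝ) : ℂ) • w, ?_, ?_⟩
  · rw [norm_smul]
    have : ‖w‖ ≠ 0 := norm_ne_zero_iff.2 hw
    simp [this]
  · rw [map_smul, hSw, smul_comm]

lemma exists_seq (S : L2 →L[ℂ] L2)
    (hS0 : ∀ x : L2, (S x : ∀ _ : ℕ, ℂ) 0 = 0)
    (hS : ∀ (x : L2) (n : ℕ), (S x : ∀ _ : ℕ, ℂ) (n + 1) = (x : ∀ _ : ℕ, ℂ) n)
    (l : ℂ) (hl : ‖l‖ = 1) :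
    ∃ v : ℕ → L2, (∀ n, ‖v n‖ = 1) ∧ R v S l ∧ R v (star S) (conj l) := by
  let e : ℕ → ℝ := fun n => 1 / ((n : ℝ) + 1)
  have he : Tendsto e atTop (𝓝 0) := tendsto_one_div_add_atTop_nhds_zero_nat
  have he0 : ∀ n, 0 < e n := fun n => by positivity
  have he1 : ∀ n, e n ≤ 1 := fun n => by
    have : (0 : ℝ) ≤ n := n.cast_nonneg
    exact div_le_one_of_le₀ (by linarith) (by linarith)
  have : ∀ n, ∃ x : L2, ‖x‖ = 1 ∧ star S x = (((1 - e n : ℝ) : ℂ) * conj l) • x := by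
    intro n
    refine exists_vec S hS0 hS _ ?_
    rw [norm_mul, RCLike.norm_conj, hl, mul_one, Complex.norm_real, Real.norm_eq_abs,
      abs_of_nonneg (by linarith [he1 n])]
    linarith [he0 n]
  choose v hv hSv using this
  refine ⟨v, hv, ?_, ?_⟩
  · rw [R, tendsto_zero_iff_norm_tendsto_zero]
    have key : ∀ n, ‖S (v n) - l • v n‖ = √(2 * e n) := by
      intro n
      rw [eq_comm, Real.sqrt_eq_iff_mul_self_eq (by linarith [he0 n]) (norm_nonneg _), ← pow_two,
        norm_sub_sq (𝕜 := ℂ)]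
      have h1 : ‖S (v n)‖ = 1 := by
        have h2 : inner ℂ (S (v n)) (S (v n)) = inner ℂ (v n) (v n) := by
          rw [← ContinuousLinearMap.adjoint_inner_left, ← ContinuousLinearMap.star_eq_adjoint,
            ← mul_apply_eq_comp, star_mul_self S hS0 hS,
            one_apply_eq_self]
        rw [inner_self_eq_norm_sq_to_K, inner_self_eq_norm_sq_to_K, hv] at h2
        have h3 : ‖S (v n)‖ ^ 2 = 1 := by
          have h2' : (((‖S (v n)‖ ^ 2 : ℝ)) : ℂ) = ((1 : ℝ) : ℂ) := by
            push_cast; simpa using h2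
          exact_mod_cast h2'
        nlinarith [norm_nonneg (S (v n))]
      have h4 : inner ℂ (S (v n)) (l • v n) = ((1 - e n : ℝ) : ℂ) := by
        rw [inner_smul_right, ← ContinuousLinearMap.adjoint_inner_right,
          ← ContinuousLinearMap.star_eq_adjoint, hSv, inner_smul_right,
          inner_self_eq_norm_sq_to_K, hv]
        have : l * conj l = 1 := by
          rw [Complex.mul_conj, Complex.normSq_eq_norm_sq, hl]; simp
        calc _ = (((1 - e n : ℝ) : ℂ)) * (l * conj l) := by simp; ring
          _ = _ := by rw [this, mul_one]
      rw [h4, h1, norm_smul, hl, hv]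
      simp only [RCLike.re_to_complex, Complex.ofReal_re]
      ring
    simp only [key]
    have := (Real.continuous_sqrt.tendsto _).comp (he.const_mul 2)
    rwa [mul_zero, Real.sqrt_zero] at this
  · rw [R, tendsto_zero_iff_norm_tendsto_zero]
    refine he.congr fun n => ?_
    rw [hSv, ← sub_smul, norm_smul, hv, mul_one]
    have : ((1 - e n : ℝ) : ℂ) * conj l - conj l = -((e n : ℝ) : ℂ) * conj l := by
      push_cast; ring
    rw [this, norm_mul, RCLike.norm_conj, hl, mul_one, norm_neg, Complex.norm_real,
      Real.norm_eq_abs, abs_of_pos (he0 n)]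

lemma general_aux (S : H →L[ℂ] H) (hstar : star S * S = 1)
    (A : StarSubalgebra ℂ (H →L[ℂ] H)) (hcl : IsClosed (A : Set (H →L[ℂ] H))) (hmem : S ∈ A)
    (hmin : ∀ B : StarSubalgebra ℂ (H →L[ℂ] H), IsClosed (B : Set (H →L[ℂ] H)) → S ∈ B → A ≤ B)
    (hext : ∀ χ ψ : WeakDual.characterSpace ℂ A, χ ⟨S, hmem⟩ = ψ ⟨S, hmem⟩ → χ = ψ)
    (hex : ∀ l : ℂ, ‖l‖ = 1 →
      ∃ v : ℕ → H, (∀ n, ‖v n‖ = 1) ∧ R v S l ∧ R v (star S) (conj l)) :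
    ∃ h : WeakDual.characterSpace ℂ A ≃ₜ Metric.sphere (0 : ℂ) 1,
      ∀ χ, (h χ : ℂ) = χ ⟨S, hmem⟩ := by
  have : CompleteSpace A := hcl.completeSpace_coe
  let _ : CStarAlgebra A := { (inferInstance : NormedRing A), (inferInstance : StarRing A),
    (inferInstance : NormedAlgebra ℂ A), (inferInstance : CStarRing A),
    (inferInstance : StarModule ℂ A), this with }
  let s : A := ⟨S, hmem⟩
  have hss : star s * s = 1 := Subtype.ext hstar
  have hnorm : ∀ χ : WeakDual.characterSpace ℂ A, χ s ∈ Metric.sphere (0 : ℂ) 1 := by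
    intro χ
    have h1 : χ (star s * s) = 1 := by rw [hss, map_one]
    rw [map_mul, map_star] at h1
    have h2 := congrArg norm h1
    rw [norm_mul, norm_star, norm_one] at h2
    rw [mem_sphere_zero_iff_norm]
    nlinarith [norm_nonneg (χ s)]
  let f : WeakDual.characterSpace ℂ A → Metric.sphere (0 : ℂ) 1 := fun χ => ⟨χ s, hnorm χ⟩
  have hf : Continuous f := by
    refine Continuous.subtype_mk ?_ _
    exact (WeakDual.eval_continuous s).comp continuous_subtype_val
  have hinj : Function.Injective f := fun χ ψ h => hext χ ψ (congrArg Subtype.val h)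
  have hsurj : Function.Surjective f := by
    rintro ⟨l, hl⟩
    rw [mem_sphere_zero_iff_norm] at hl
    obtain ⟨v, hv, h1, h2⟩ := hex l hl
    obtain ⟨χ, hχ⟩ := exists_char hv A (hmin _ (B_closed hv) ⟨l, h1, h2⟩)
    refine ⟨WeakDual.CharacterSpace.equivAlgHom.symm χ, Subtype.ext ?_⟩
    exact (hχ s).unique hv h1
  exact ⟨hf.homeoOfEquivCompactToT2 (f := Equiv.ofBijective f ⟨hinj, hsurj⟩), fun χ => rfl⟩

lemma char_star (A : StarSubalgebra ℂ (H →L[ℂ] H)) (hcl : IsClosed (A : Set (H →L[ℂ] H)))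
    (χ : WeakDual.characterSpace ℂ A) (a : A) : χ (star a) = star (χ a) := by
  have : CompleteSpace A := hcl.completeSpace_coe
  let _ : CStarAlgebra A := { (inferInstance : NormedRing A), (inferInstance : StarRing A),
    (inferInstance : NormedAlgebra ℂ A), (inferInstance : CStarRing A),
    (inferInstance : StarModule ℂ A), this with }
  exact map_star χ a

lemma char_ext (S : H →L[ℂ] H) (A : StarSubalgebra ℂ (H →L[ℂ] H))
    (hcl : IsClosed (A : Set (H →L[ℂ] H))) (hmem : S ∈ A)
    (hA : A = StarAlgebra.elemental ℂ S)
    (χ ψ : WeakDual.characterSpace ℂ A) (h : χ ⟨S, hmem⟩ = ψ ⟨S, hmem⟩) : χ = ψ := by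
  have hχ : Continuous χ := map_continuous χ
  have hψ : Continuous ψ := map_continuous ψ
  have key : ∀ (T : H →L[ℂ] H), T ∈ StarAlgebra.elemental ℂ S → ∀ hT : T ∈ A,
      χ ⟨T, hT⟩ = ψ ⟨T, hT⟩ := by
    intro T hT0
    have hm : ∀ {u}, u ∈ StarAlgebra.elemental ℂ S → u ∈ A := fun hu => hA ▸ hu
    induction hT0 using StarAlgebra.elemental.induction_on with
    | self => exact fun _ => h
    | star_self =>
      intro hT
      have h1 := char_star A hcl χ ⟨S, hmem⟩
      have h2 := char_star A hcl ψ ⟨S, hmem⟩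
      rw [h, ← h2] at h1
      exact h1
    | algebraMap r =>
      intro hT
      exact (AlgHomClass.commutes χ r).trans (AlgHomClass.commutes ψ r).symm
    | add u hu v hv ihu ihv =>
      intro hT
      have h1 := map_add χ ⟨u, hm hu⟩ ⟨v, hm hv⟩
      have h2 := map_add ψ ⟨u, hm hu⟩ ⟨v, hm hv⟩
      rw [ihu, ihv, ← h2] at h1
      exact h1
    | mul u hu v hv ihu ihv =>
      intro hT
      have h1 := map_mul χ ⟨u, hm hu⟩ ⟨v, hm hv⟩
      have h2 := map_mul ψ ⟨u, hm hu⟩ ⟨v, hm hv⟩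
      rw [ihu, ihv, ← h2] at h1
      exact h1
    | closure s hs ih v hv =>
      intro hT
      obtain ⟨x, hx, hlim⟩ := mem_closure_iff_seq_limit.1 hv
      have hl : Tendsto (fun n => (⟨x n, hm (hs (hx n))⟩ : A)) atTop (𝓝 ⟨v, hT⟩) :=
        tendsto_subtype_rng.2 hlim
      have h1 := (hχ.tendsto _).comp hl
      have h2 := (hψ.tendsto _).comp hl
      refine tendsto_nhds_unique h1 (h2.congr fun n => ?_)
      exact (ih (x n) (hx n) _).symm
  refine DFunLike.ext χ ψ fun a => key a (hA ▸ a.2) a.2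

lemma general (S : H →L[ℂ] H) (hstar : star S * S = 1)
    (hex : ∀ l : ℂ, ‖l‖ = 1 →
      ∃ v : ℕ → H, (∀ n, ‖v n‖ = 1) ∧ R v S l ∧ R v (star S) (conj l)) :
    ∃ h : WeakDual.characterSpace ℂ
        ((StarAlgebra.adjoin ℂ ({S} : Set (H →L[ℂ] H))).topologicalClosure) ≃ₜ
          Metric.sphere (0 : ℂ) 1,
      ∀ χ, (h χ : ℂ) = χ ⟨S, (StarSubalgebra.le_topologicalClosure _)
        (StarAlgebra.subset_adjoin ℂ _ rfl)⟩ := by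
  refine general_aux S hstar _ (StarSubalgebra.isClosed_topologicalClosure _) _ ?_ ?_ hex
  · intro B hB hS
    refine StarSubalgebra.topologicalClosure_minimal ?_ hB
    refine StarAlgebra.adjoin_le ?_
    rintro _ rfl
    exact hS
  · exact char_ext S _ (StarSubalgebra.isClosed_topologicalClosure _) _ rfl

end Toep

/-- The character space of the Toeplitz algebra `𝒯` (the smallest norm-closed
star-subalgebra of the bounded operators on `ℓ²(ℕ, ℂ)` containing the unilateral shift `S`
and the identity), equipped with its weak* topology, is homeomorphic to the unit circle
`𝕋 = {λ ∈ ℂ : |λ| = 1}` via the map sending a character `χ` to `χ(S)`. -/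
theorem stmt_17 (S : lp (fun _ : ℕ => ℂ) 2 →L[ℂ] lp (fun _ : ℕ => ℂ) 2)
    (hS0 : ∀ x : lp (fun _ : ℕ => ℂ) 2, (S x : ∀ _ : ℕ, ℂ) 0 = 0)
    (hS : ∀ (x : lp (fun _ : ℕ => ℂ) 2) (n : ℕ),
      (S x : ∀ _ : ℕ, ℂ) (n + 1) = (x : ∀ _ : ℕ, ℂ) n) :
    ∃ h : WeakDual.characterSpace ℂ
        ((StarAlgebra.adjoin ℂ ({S} : Set (lp (fun _ : ℕ => ℂ) 2 →L[ℂ]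
          lp (fun _ : ℕ => ℂ) 2))).topologicalClosure) ≃ₜ Metric.sphere (0 : ℂ) 1,
      ∀ χ, (h χ : ℂ) = χ ⟨S, (StarSubalgebra.le_topologicalClosure _)
        (StarAlgebra.subset_adjoin ℂ _ rfl)⟩ := by

  exact Toep.general S (Toep.star_mul_self S hS0 hS) (Toep.exists_seq S hS0 hS)
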